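/- Let I be a parasimplex. Then there exists a unique positive integer n such that: (i) for every y ∈ I the set {x ∈ I ∣ y ≤ x < y + 1} has exactly n elements, and (ii) there is an order isomorphism f : I → ℤ satisfying f(x + m) = f(x) + m·n for all x ∈ I and all m ∈ ℤ. (In the paper's notation: every parasimplex is isomorphic to [n]_Λ = (1/n)ℤ for a uniquely determined positive integer n, which equals the cardinality of {x ∈ I ∣ y ≤ x < y + 1} for any y ∈ I.) -/

import Mathlib

/-- A parasimplex: a nonempty linearly ordered set `I` with an action of `ℤ` by
order-preserving bijections `(x, m) ↦ act x m` such that all closed intervals are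
finite and `x < x + 1` for all `x`. -/
structure Parasimplex (I : Type*) [LinearOrder I] where
  nonempty : Nonempty I
  act : I → ℤ → I
  act_zero : ∀ x : I, act x 0 = x
  act_add : ∀ (x : I) (m k : ℤ), act (act x m) k = act x (m + k)
  act_mono : ∀ m : ℤ, Monotone fun x : I => act x m
  interval_finite : ∀ a b : I, (Set.Icc a b).Finite
  lt_act_one : ∀ x : I, x < act x 1

/-- Every parasimplex is isomorphic to `[n]_Λ = (1/n)ℤ` for a uniquely determined
positive integer `n`, which equals the cardinality of `{x ∈ I ∣ y ≤ x < y + 1}` for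
any `y ∈ I`.  Here `(1/n)ℤ` is identified with `ℤ` carrying the `ℤ`-action
`m • k = k + m·n` via multiplication by `n`. -/
theorem parasimplex_classification {I : Type*} [LinearOrder I] (P : Parasimplex I) :
    ∃! n : ℕ, 0 < n ∧
      (∀ y : I, Set.ncard {x : I | y ≤ x ∧ x < P.act y 1} = n) ∧
      ∃ f : I ≃o ℤ, ∀ (x : I) (m : ℤ), f (P.act x m) = f x + m * (n : ℤ) := by
  classical
  obtain ⟨i0⟩ := P.nonempty
  haveI : Nonempty I := ⟨i0⟩
  letI : LocallyFiniteOrder I := LocallyFiniteOrder.ofFiniteIcc P.interval_finite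
  letI : SuccOrder I := LinearLocallyFiniteOrder.succOrder I
  letI : PredOrder I := LinearLocallyFiniteOrder.predOrder I
  have hlt : ∀ x, P.act x (-1) < x := by
    intro x
    have h := P.lt_act_one (P.act x (-1))
    rw [P.act_add] at h
    simpa [P.act_zero] using h
  haveI : NoMaxOrder I := ⟨fun x => ⟨_, P.lt_act_one x⟩⟩
  haveI : NoMinOrder I := ⟨fun x => ⟨_, hlt x⟩⟩
  let f : I ≃o ℤ := orderIsoIntOfLinearSuccPredArch
  let e : I ≃ I :=
    { toFun := fun x => P.act x 1
      invFun := fun x => P.act x (-1)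
      left_inv := fun x => by simp [P.act_add, P.act_zero]
      right_inv := fun x => by simp [P.act_add, P.act_zero] }
  let s : I ≃o I := e.toOrderIso (P.act_mono 1) (P.act_mono (-1))
  let g : ℤ ≃o ℤ := (f.symm.trans s).trans f
  have hg : ∀ x, f (P.act x 1) = g (f x) := fun x => by
    change _ = f (P.act (f.symm (f x)) 1)
    rw [f.symm_apply_apply]
  have hs : ∀ k, g (k + 1) = g k + 1 := fun k => by
    have := g.map_succ k
    simpa [Int.succ_eq_succ, Int.succ] using this
  have hc : ∀ k, g k = k + g 0 := by
    intro k
    induction k using Int.induction_on with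
    | zero => simp
    | succ i ih => rw [hs, ih]; ring
    | pred i ih =>
      have := hs (-(i : ℤ) - 1)
      rw [sub_add_cancel] at this
      omega
  have hf1 : ∀ x, f (P.act x 1) = f x + g 0 := fun x => by rw [hg, hc]
  have hpos : 0 < g 0 := by
    have := f.strictMono (P.lt_act_one i0)
    rw [hf1] at this
    omega
  obtain ⟨n, hn⟩ := Int.eq_ofNat_of_zero_le hpos.le
  rw [hn] at hf1 hpos
  have hcard : ∀ y : I, Set.ncard {x : I | y ≤ x ∧ x < P.act y 1} = n := by
    intro y
    have himg : f '' {x : I | y ≤ x ∧ x < P.act y 1} = ↑(Finset.Ico (f y) (f y + n)) := by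
      ext k
      rw [← hf1]
      constructor
      · rintro ⟨x, ⟨h1, h2⟩, rfl⟩
        simpa using ⟨h1, h2⟩
      · intro h
        refine ⟨f.symm k, ?_, f.apply_symm_apply k⟩
        rw [Finset.coe_Ico] at h
        exact ⟨(f.le_symm_apply).2 h.1, (f.symm_apply_lt).2 h.2⟩
    rw [← Set.ncard_image_of_injective _ f.injective, himg, Set.ncard_coe_finset]
    simp
  refine ⟨n, ⟨by exact_mod_cast hpos, hcard, f, ?_⟩, ?_⟩
  · intro x m
    induction m using Int.induction_on with
    | zero => simp [P.act_zero]
    | succ i ih => rw [← P.act_add, hf1, ih]; ring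
    | pred i ih =>
      have := hf1 (P.act x (-(i : ℤ) - 1))
      rw [P.act_add, sub_add_cancel, ih] at this
      linarith
  · rintro m ⟨_, hm, _⟩
    rw [← hm i0, hcard i0]
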